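/- arXiv:2203.00958 — 2 statements merged into one kernel-verified Lean document; each statement's English description precedes it below -/
import Mathlib

section
/- Let F be a finite field with q elements, r ∈ (0,1) and δ ∈ (0, 1−1/q). For each integer n ≥ 1 let k = ⌊rn⌋ and, for a matrix M ∈ F^{k×n}, let C_M = {bM : b ∈ F^k} ≤ F^n be the linear code spanned by the rows of M. Let P_n = |{M ∈ F^{k×n} : every nonzero codeword of C_M has Hamming weight > δn}| / q^{kn}. Then lim_{n→∞} P_n = 1 if r < g_q(δ), and lim_{n→∞} P_n = 0 if r > g_q(δ). -/
/-- The `q`-entropy function `h_q(δ)`. -/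
noncomputable def qEntropy (q : ℕ) (δ : ℝ) : ℝ :=
  δ * Real.logb q ((q : ℝ) - 1) - δ * Real.logb q δ - (1 - δ) * Real.logb q (1 - δ)

/-- The asymptotic Gilbert–Varshamov bound `g_q(δ) = 1 - h_q(δ)`. -/
noncomputable def gvBound (q : ℕ) (δ : ℝ) : ℝ := 1 - qEntropy q δ

/-- The probability (for a uniformly random `k × n` matrix `M` with `k = ⌊rn⌋`) that
every nonzero codeword of the row-span `C_M = {bM}` has Hamming weight `> δn`. -/
noncomputable def Plin (F : Type) [Field F] [Fintype F] [DecidableEq F]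
    (q : ℕ) (r δ : ℝ) (n : ℕ) : ℝ :=
  ({M : Matrix (Fin ⌊r * (n : ℝ)⌋₊) (Fin n) F |
      ∀ b : Fin ⌊r * (n : ℝ)⌋₊ → F, Matrix.vecMul b M ≠ 0 →
        δ * n < (hammingNorm (Matrix.vecMul b M) : ℝ)}.ncard : ℝ) /
    (q : ℝ) ^ (⌊r * (n : ℝ)⌋₊ * n)

open Finset Filter Topology

section WordCounting

variable {F : Type*} [Field F] [Fintype F] [DecidableEq F]

theorem sum_pow_hammingNorm {R : Type*} [CommSemiring R] (x : R) (n : ℕ) :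
    ∑ v : Fin n → F, x ^ hammingNorm v = (1 + ((Fintype.card F - 1 : ℕ) : R) * x) ^ n := by
  have hx : ∑ a : F, (if a ≠ 0 then x else 1) = 1 + ((Fintype.card F - 1 : ℕ) : R) * x := by
    rw [← Finset.add_sum_erase _ _ (mem_univ (0 : F)),
      Finset.sum_congr rfl fun a ha => if_pos (Finset.ne_of_mem_erase ha)]
    simp [Finset.card_erase_of_mem, Finset.card_univ]
  calc ∑ v : Fin n → F, x ^ hammingNorm v
      = ∑ v : Fin n → F, ∏ i, (if v i ≠ 0 then x else 1) := by
        refine Finset.sum_congr rfl fun v _ => ?_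
        rw [Finset.prod_ite, Finset.prod_const, Finset.prod_const_one, mul_one, hammingNorm]
    _ = ∏ _i : Fin n, ∑ a : F, (if a ≠ 0 then x else 1) := by
        rw [Finset.prod_univ_sum, Fintype.piFinset_univ]
    _ = _ := by rw [hx]; simp

theorem card_hammingNorm_eq (n m : ℕ) :
    #{v : Fin n → F | hammingNorm v = m} = (Fintype.card F - 1) ^ m * n.choose m := by
  have h := congrArg (fun p : Polynomial ℕ => p.coeff m)
    (sum_pow_hammingNorm (F := F) (Polynomial.X : Polynomial ℕ) n)
  have h2 : (1 + ((Fintype.card F - 1 : ℕ) : Polynomial ℕ) * Polynomial.X) ^ n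
      = ((1 + Polynomial.X : Polynomial ℕ) ^ n).comp
          (Polynomial.C (Fintype.card F - 1) * Polynomial.X) := by
    simp
  simp only [h2, Polynomial.comp_C_mul_X_coeff, Polynomial.finsetSum_coeff,
    Polynomial.coeff_X_pow, Polynomial.coeff_one_add_X_pow] at h
  rw [Finset.card_filter]
  simpa [eq_comm, mul_comm] using h

end WordCounting

theorem pow_self_le_succ_mul_choose_mul {n m : ℕ} (hm : m ≤ n) :
    n ^ n ≤ (n + 1) * (n.choose m * (m ^ m * (n - m) ^ (n - m))) := by
  obtain ⟨l, rfl⟩ := Nat.exists_eq_add_of_le hm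
  rw [Nat.add_sub_cancel_left]
  rcases Nat.eq_zero_or_pos l with rfl | hl
  · simp
    nlinarith [Nat.zero_le (m ^ m)]
  rcases Nat.eq_zero_or_pos m with rfl | hm0
  · simp
    nlinarith [Nat.zero_le (l ^ l)]
  set N := m + l with hN
  let t : ℕ → ℕ := fun j => m ^ j * l ^ (N - j) * N.choose j
  have step (j : ℕ) (hj : j < N) : t (j + 1) * ((j + 1) * l) = t j * ((N - j) * m) := by
    have h := Nat.choose_succ_right_eq N j
    have e : N - j = N - (j + 1) + 1 := by omega
    simp only [t]
    calc _ = m ^ (j + 1) * l ^ (N - (j + 1)) * l * (N.choose (j + 1) * (j + 1)) := by ring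
      _ = m ^ (j + 1) * l ^ (N - (j + 1) + 1) * (N.choose j * (N - j)) := by rw [h]; ring
      _ = _ := by rw [← e]; ring
  have up (j : ℕ) (hj : j < m) : t j ≤ t (j + 1) := by
    have h1 : (j + 1) * l ≤ (N - j) * m := by
      rw [mul_comm]; exact Nat.mul_le_mul (by omega) hj
    exact Nat.le_of_mul_le_mul_right
      ((Nat.mul_le_mul_left _ h1).trans_eq (step j (by omega)).symm) (by positivity)
  have down (j : ℕ) (hj : m ≤ j) (hjN : j < N) : t (j + 1) ≤ t j := by
    have h1 : (N - j) * m ≤ (j + 1) * l := by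
      rw [mul_comm]; exact Nat.mul_le_mul (by omega) (by omega)
    exact Nat.le_of_mul_le_mul_right
      ((step j hjN).trans_le (Nat.mul_le_mul_left _ h1)) (by positivity)
  have below (j : ℕ) (hj : j ≤ m) : t j ≤ t m := by
    induction hj using Nat.decreasingInduction with
    | self => exact le_rfl
    | of_succ j hj ih => exact (up j hj).trans ih
  have above (j : ℕ) (hj : m ≤ j) : j ≤ N → t j ≤ t m := by
    induction j, hj using Nat.le_induction with
    | base => exact fun _ => le_rfl
    | succ j hj ih => exact fun h => (down j hj h).trans (ih (by omega))
  have hsum : N ^ N = ∑ j ∈ range (N + 1), t j := by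
    conv_lhs => rw [hN]
    rw [add_pow]
    simp [t, hN]
  have htm : t m = N.choose m * (m ^ m * l ^ l) := by
    simp only [t, hN, Nat.add_sub_cancel_left]; ring
  rw [hsum, ← htm]
  refine (Finset.sum_le_card_nsmul _ _ (t m) fun j hj => ?_).trans (by simp)
  rcases le_total j m with h | h
  · exact below j h
  · exact above j h (by simpa [Nat.lt_succ_iff] using hj)

theorem card_filter_mem_mul_card_of_surjective {G H : Type*} [AddCommGroup G] [AddCommGroup H]
    [Fintype G] [Fintype H] [DecidableEq H] (f : G →+ H) (hf : Function.Surjective f)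
    (T : Finset H) : #{g | f g ∈ T} * Fintype.card H = #T * Fintype.card G := by
  have hfib (y : H) : #{g | f g = y} = #{g | f g = 0} := by
    refine AddMonoidHom.card_fiber_eq_of_mem_range f ?_ ?_ <;> simp [hf _]
  have h1 : Fintype.card G = Fintype.card H * #{g | f g = 0} := by
    rw [← Finset.card_univ, Finset.card_eq_sum_card_fiberwise (f := f) (t := univ) (by simp)]
    simp [hfib]
  have h2 : #{g | f g ∈ T} = #T * #{g | f g = 0} := by
    rw [Finset.card_eq_sum_card_fiberwise (f := f) (t := T) (by intro x; simp)]
    rw [← smul_eq_mul, ← Finset.sum_const]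
    refine Finset.sum_congr rfl fun y hy => ?_
    rw [← hfib y, Finset.filter_filter]
    congr 1
    ext g
    simp only [mem_filter, mem_univ, true_and]
    exact ⟨fun h => h.2, fun h => ⟨h ▸ hy, h⟩⟩
  rw [h1, h2]; ring

section RandomMatrix

open Matrix

variable {F : Type*} [Field F] {ι κ : Type*} [Fintype ι] [DecidableEq ι]

/-- Left multiplication by a row vector, as an additive map on matrices. -/
def vecMulAddHom (κ : Type*) (b : ι → F) : Matrix ι κ F →+ (κ → F) where
  toFun M := b ᵥ* M
  map_zero' := vecMul_zero b
  map_add' M N := vecMul_add M N b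

theorem vecMul_single_row (b : ι → F) (i : ι) (x : κ → F) :
    b ᵥ* (Matrix.of fun r c => if r = i then x c else 0) = b i • x := by
  ext c
  simp [vecMul, dotProduct]

theorem vecMulAddHom_surjective {b : ι → F} (hb : b ≠ 0) :
    Function.Surjective (vecMulAddHom κ b) := by
  obtain ⟨i, hi⟩ := Function.ne_iff.1 hb
  intro v
  refine ⟨Matrix.of fun r c => if r = i then ((b i)⁻¹ • v) c else 0, ?_⟩
  exact (vecMul_single_row b i _).trans (smul_inv_smul₀ hi v)

theorem vecMulAddHom_prod_surjective {b b' : ι → F} (hb : b ≠ 0) (hb' : ∀ c : F, b' ≠ c • b) :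
    Function.Surjective ((vecMulAddHom κ b).prod (vecMulAddHom κ b')) := by
  obtain ⟨i, hi⟩ := Function.ne_iff.1 hb
  obtain ⟨j, hj⟩ := Function.ne_iff.1 (hb' (b' i / b i))
  simp only [Pi.zero_apply, Pi.smul_apply, smul_eq_mul, ne_eq] at hi hj
  have hD : b i * b' j - b' i * b j ≠ 0 := by
    intro h
    apply hj
    field_simp
    linear_combination h
  set D := b i * b' j - b' i * b j with hD'
  rintro ⟨u, v⟩
  refine ⟨(Matrix.of fun r c => if r = i then (D⁻¹ • (b' j • u - b j • v)) c else 0)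
    + (Matrix.of fun r c => if r = j then (D⁻¹ • (b i • v - b' i • u)) c else 0), ?_⟩
  ext c
  · change (b ᵥ* (_ + _)) c = u c
    rw [vecMul_add, vecMul_single_row, vecMul_single_row]
    simp only [Pi.add_apply, Pi.smul_apply, Pi.sub_apply, smul_eq_mul]
    field_simp
    rw [hD']; ring
  · change (b' ᵥ* (_ + _)) c = v c
    rw [vecMul_add, vecMul_single_row, vecMul_single_row]
    simp only [Pi.add_apply, Pi.smul_apply, Pi.sub_apply, smul_eq_mul]
    field_simp
    rw [hD']; ring

variable [Fintype F] [DecidableEq F] [Fintype κ] [DecidableEq κ]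

theorem card_vecMul_mem {b : ι → F} (hb : b ≠ 0) (S : Finset (κ → F)) :
    (#{M : Matrix ι κ F | b ᵥ* M ∈ S} : ℝ) =
      Fintype.card (Matrix ι κ F) * ((#S : ℝ) / Fintype.card (κ → F)) := by
  have h := card_filter_mem_mul_card_of_surjective _ (vecMulAddHom_surjective (κ := κ) hb) S
  have h0 : (Fintype.card (κ → F) : ℝ) ≠ 0 := by exact_mod_cast Fintype.card_ne_zero
  rw [mul_div_assoc', eq_div_iff h0, mul_comm (Fintype.card (Matrix ι κ F) : ℝ)]
  exact_mod_cast h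

theorem card_vecMul_mem_and_vecMul_mem {b b' : ι → F} (hb : b ≠ 0) (hb' : ∀ c : F, b' ≠ c • b)
    (S : Finset (κ → F)) :
    (#{M : Matrix ι κ F | b ᵥ* M ∈ S ∧ b' ᵥ* M ∈ S} : ℝ) =
      Fintype.card (Matrix ι κ F) * ((#S : ℝ) / Fintype.card (κ → F)) ^ 2 := by
  have h := card_filter_mem_mul_card_of_surjective _
    (vecMulAddHom_prod_surjective (κ := κ) hb hb') (S ×ˢ S)
  have h0 : (Fintype.card (κ → F) : ℝ) ≠ 0 := by exact_mod_cast Fintype.card_ne_zero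
  rw [div_pow, mul_div_assoc', eq_div_iff (pow_ne_zero 2 h0),
    mul_comm (Fintype.card (Matrix ι κ F) : ℝ)]
  simp only [mem_product, card_product, Fintype.card_prod] at h
  rw [sq, sq]
  exact_mod_cast h

theorem sum_card_vecMul_mem {S : Finset (κ → F)} (hS : 0 ∉ S) :
    ∑ M : Matrix ι κ F, (#{b : ι → F | b ᵥ* M ∈ S} : ℝ) =
      Fintype.card (Matrix ι κ F) * ((Fintype.card (ι → F) - 1) *
        ((#S : ℝ) / Fintype.card (κ → F))) := by
  calc ∑ M : Matrix ι κ F, (#{b : ι → F | b ᵥ* M ∈ S} : ℝ)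
      = ∑ b : ι → F, (#{M : Matrix ι κ F | b ᵥ* M ∈ S} : ℝ) := by
        simp only [Finset.card_filter, Nat.cast_sum]
        exact Finset.sum_comm
    _ = ∑ b ∈ univ.erase (0 : ι → F), (#{M : Matrix ι κ F | b ᵥ* M ∈ S} : ℝ) := by
        rw [Finset.sum_erase]
        simp [hS]
    _ = _ := by
        rw [Finset.sum_congr rfl fun b hb => card_vecMul_mem (Finset.ne_of_mem_erase hb) S]
        rw [Finset.sum_const, Finset.card_erase_of_mem (mem_univ _), Finset.card_univ,
          nsmul_eq_mul, Nat.cast_sub Fintype.card_pos]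
        push_cast
        ring

theorem sum_card_vecMul_mem_sq_le {S : Finset (κ → F)} (hS : 0 ∉ S) :
    ∑ M : Matrix ι κ F, (#{b : ι → F | b ᵥ* M ∈ S} : ℝ) ^ 2 ≤
      Fintype.card (Matrix ι κ F) * (((Fintype.card (ι → F) - 1) *
        ((#S : ℝ) / Fintype.card (κ → F))) ^ 2 + Fintype.card F * ((Fintype.card (ι → F) - 1) *
        ((#S : ℝ) / Fintype.card (κ → F)))) := by
  set A : ℝ := ((Fintype.card (Matrix ι κ F) : ℕ) : ℝ)
  set s : ℝ := (#S : ℝ) / Fintype.card (κ → F)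
  have hs : 0 ≤ s := by positivity
  have hcard : (#(univ.erase (0 : ι → F)) : ℝ) = Fintype.card (ι → F) - 1 := by
    rw [Finset.card_erase_of_mem (mem_univ _), Finset.card_univ, Nat.cast_sub Fintype.card_pos,
      Nat.cast_one]
  have key {b : ι → F} (hb : b ≠ 0) :
      ∑ b' ∈ univ.erase (0 : ι → F), (#{M : Matrix ι κ F | b ᵥ* M ∈ S ∧ b' ᵥ* M ∈ S} : ℝ) ≤
        (Fintype.card (ι → F) - 1) * (A * s ^ 2) + Fintype.card F * (A * s) := by
    rw [← Finset.sum_filter_add_sum_filter_not _ (fun b' => ∀ c : F, b' ≠ c • b)]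
    refine add_le_add ?_ ?_
    · refine (Finset.sum_le_card_nsmul _ _ (A * s ^ 2) fun b' hb' => ?_).trans ?_
      · exact (card_vecMul_mem_and_vecMul_mem hb (mem_filter.1 hb').2 S).le
      · rw [nsmul_eq_mul, ← hcard]
        gcongr
        exact filter_subset _ _
    · refine (Finset.sum_le_card_nsmul _ _ (A * s) fun b' _ => ?_).trans ?_
      · rw [← card_vecMul_mem hb S]
        gcongr
        exact fun h => h.1
      · rw [nsmul_eq_mul]
        gcongr
        refine (Finset.card_le_card (t := univ.image fun c : F => c • b) ?_).trans
          (card_image_le.trans_eq Finset.card_univ)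
        intro b' hb'
        have := (mem_filter.1 hb').2
        push Not at this
        obtain ⟨c, hc⟩ := this
        exact mem_image.2 ⟨c, mem_univ _, hc.symm⟩
  calc ∑ M : Matrix ι κ F, (#{b : ι → F | b ᵥ* M ∈ S} : ℝ) ^ 2
      = ∑ b : ι → F, ∑ b' : ι → F, (#{M : Matrix ι κ F | b ᵥ* M ∈ S ∧ b' ᵥ* M ∈ S} : ℝ) := by
        simp only [Finset.card_filter, Nat.cast_sum, sq, Finset.sum_mul_sum]
        rw [Finset.sum_comm]
        refine Finset.sum_congr rfl fun b _ => ?_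
        rw [Finset.sum_comm]
        refine Finset.sum_congr rfl fun b' _ => Finset.sum_congr rfl fun M _ => ?_
        by_cases h : b ᵥ* M ∈ S <;> simp [h]
    _ = ∑ b ∈ univ.erase (0 : ι → F), ∑ b' ∈ univ.erase (0 : ι → F),
          (#{M : Matrix ι κ F | b ᵥ* M ∈ S ∧ b' ᵥ* M ∈ S} : ℝ) := by
        rw [Finset.sum_erase _ (by simp [hS])]
        refine Finset.sum_congr rfl fun b _ => ?_
        rw [Finset.sum_erase _ (by simp [hS])]
    _ ≤ ∑ b ∈ univ.erase (0 : ι → F),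
          ((Fintype.card (ι → F) - 1) * (A * s ^ 2) + Fintype.card F * (A * s)) :=
        Finset.sum_le_sum fun b hb => key (Finset.ne_of_mem_erase hb)
    _ = _ := by
        rw [Finset.sum_const, nsmul_eq_mul, hcard]; ring

theorem card_exists_vecMul_mem_le {S : Finset (κ → F)} (hS : 0 ∉ S) :
    (#{M : Matrix ι κ F | ∃ b : ι → F, b ᵥ* M ∈ S} : ℝ) ≤
      Fintype.card (Matrix ι κ F) * ((Fintype.card (ι → F) - 1) *
        ((#S : ℝ) / Fintype.card (κ → F))) := by
  rw [← sum_card_vecMul_mem hS, Finset.card_filter, Nat.cast_sum]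
  refine Finset.sum_le_sum fun M _ => ?_
  split_ifs with h
  · obtain ⟨b, hb⟩ := h
    exact_mod_cast Finset.card_pos.2 ⟨b, by simpa using hb⟩
  · simp

theorem card_forall_vecMul_notMem_mul_le {S : Finset (κ → F)} (hS : 0 ∉ S) :
    (#{M : Matrix ι κ F | ∀ b : ι → F, b ᵥ* M ∉ S} : ℝ) * ((Fintype.card (ι → F) - 1) *
        ((#S : ℝ) / Fintype.card (κ → F))) ^ 2 ≤
      Fintype.card (Matrix ι κ F) * (Fintype.card F * ((Fintype.card (ι → F) - 1) *
        ((#S : ℝ) / Fintype.card (κ → F)))) := by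
  have h1 := sum_card_vecMul_mem (ι := ι) hS
  have h2 := sum_card_vecMul_mem_sq_le (ι := ι) hS
  set μ : ℝ := (Fintype.card (ι → F) - 1) * ((#S : ℝ) / Fintype.card (κ → F))
  calc (#{M : Matrix ι κ F | ∀ b : ι → F, b ᵥ* M ∉ S} : ℝ) * μ ^ 2
      = ∑ M : Matrix ι κ F with ∀ b : ι → F, b ᵥ* M ∉ S,
          ((#{b : ι → F | b ᵥ* M ∈ S} : ℝ) - μ) ^ 2 := by
        rw [← nsmul_eq_mul, ← Finset.sum_const]
        refine Finset.sum_congr rfl fun M hM => ?_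
        have : #{b : ι → F | b ᵥ* M ∈ S} = 0 := by
          simpa [Finset.filter_eq_empty_iff] using (mem_filter.1 hM).2
        rw [this]; simp
    _ ≤ ∑ M : Matrix ι κ F, ((#{b : ι → F | b ᵥ* M ∈ S} : ℝ) - μ) ^ 2 :=
        Finset.sum_le_sum_of_subset_of_nonneg (subset_univ _) fun _ _ _ => sq_nonneg _
    _ = ∑ M : Matrix ι κ F, (#{b : ι → F | b ᵥ* M ∈ S} : ℝ) ^ 2
          - 2 * μ * ∑ M : Matrix ι κ F, (#{b : ι → F | b ᵥ* M ∈ S} : ℝ)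
          + Fintype.card (Matrix ι κ F) * μ ^ 2 := by
        rw [Finset.mul_sum, ← Finset.sum_sub_distrib, ← nsmul_eq_mul, ← Finset.card_univ,
          ← Finset.sum_const, ← Finset.sum_add_distrib]
        exact Finset.sum_congr rfl fun M _ => by ring
    _ ≤ _ := by rw [h1]; linarith

end RandomMatrix

theorem rpow_qEntropy_mul {q : ℕ} (hq : 2 ≤ q) (δ t : ℝ) :
    (q : ℝ) ^ (qEntropy q δ * t) = Real.exp
      (t * (δ * Real.log (q - 1) - δ * Real.log δ - (1 - δ) * Real.log (1 - δ))) := by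
  have hq1 : (1 : ℝ) < q := by exact_mod_cast hq
  have hlog : Real.log q ≠ 0 := (Real.log_pos hq1).ne'
  rw [Real.rpow_def_of_pos (by positivity), qEntropy]
  simp only [Real.logb]
  congr 1
  field_simp

theorem continuousAt_qEntropy (q : ℕ) {δ : ℝ} (hδ0 : δ ≠ 0) (hδ1 : δ ≠ 1) :
    ContinuousAt (qEntropy q) δ := by
  have h1 : 1 - δ ≠ 0 := sub_ne_zero.2 hδ1.symm
  unfold qEntropy Real.logb
  fun_prop (disch := assumption)

section HammingBall

variable {F : Type*} [Field F] [Fintype F] [DecidableEq F]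

/-- The nonzero words of Hamming weight at most `t`. -/
noncomputable def puncturedBall (F : Type*) [Field F] [Fintype F] [DecidableEq F] (n : ℕ) (t : ℝ) :
    Finset (Fin n → F) :=
  {v | v ≠ 0 ∧ (hammingNorm v : ℝ) ≤ t}

theorem zero_notMem_puncturedBall (n : ℕ) (t : ℝ) : 0 ∉ puncturedBall F n t := by
  simp [puncturedBall]

theorem card_puncturedBall_le {δ : ℝ} (hδ0 : 0 < δ) (hδ1 : δ < 1 - 1 / (Fintype.card F : ℝ))
    (n : ℕ) : (#(puncturedBall F n (δ * n)) : ℝ) ≤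
      (Fintype.card F : ℝ) ^ (qEntropy (Fintype.card F) δ * n) := by
  have hq : 2 ≤ Fintype.card F := Fintype.one_lt_card
  rw [rpow_qEntropy_mul hq]
  have hcast : ((Fintype.card F - 1 : ℕ) : ℝ) = (Fintype.card F : ℝ) - 1 := by
    rw [Nat.cast_sub (by omega), Nat.cast_one]
  have hq2 : (2 : ℝ) ≤ Fintype.card F := by exact_mod_cast hq
  set q : ℝ := (Fintype.card F : ℝ)
  have hq0 : 0 < q := by linarith
  have hqpos : 0 < q - 1 := by linarith
  have hδq : δ * q < q - 1 := by
    have := mul_lt_mul_of_pos_right hδ1 hq0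
    rwa [sub_mul, one_div, inv_mul_cancel₀ hq0.ne', one_mul] at this
  have hδ : 0 < 1 - δ := by nlinarith
  set x : ℝ := δ / ((q - 1) * (1 - δ)) with hx
  have hx0 : 0 < x := by positivity
  have hx1 : x ≤ 1 := by
    rw [hx, div_le_one (by positivity)]; nlinarith
  have hsum := sum_pow_hammingNorm (F := F) x n
  have hbase : 1 + ((Fintype.card F - 1 : ℕ) : ℝ) * x = (1 - δ)⁻¹ := by
    rw [hcast, hx]; field_simp; ring
  rw [hbase] at hsum
  have hle : (#(puncturedBall F n (δ * n)) : ℝ) * x ^ (δ * n) ≤ ((1 - δ)⁻¹) ^ n := by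
    rw [← hsum, ← nsmul_eq_mul]
    refine (Finset.card_nsmul_le_sum (puncturedBall F n (δ * n))
      (fun v => x ^ hammingNorm v) _ fun v hv => ?_).trans
      (Finset.sum_le_sum_of_subset_of_nonneg (subset_univ _) fun _ _ _ => by positivity)
    rw [← Real.rpow_natCast]
    exact Real.rpow_le_rpow_of_exponent_ge hx0 hx1 (mem_filter.1 hv).2.2
  rw [← le_div_iff₀ (by positivity)] at hle
  refine hle.trans_eq ?_
  rw [← Real.rpow_natCast, Real.rpow_def_of_pos (by positivity), Real.rpow_def_of_pos hx0,
    ← Real.exp_sub, hx, Real.log_div (by positivity) (by positivity),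
    Real.log_mul (by positivity) (by positivity), Real.log_inv]
  congr 1
  ring

theorem rpow_qEntropy_le_card_puncturedBall {n m : ℕ} (hm : 0 < m) (hmn : m < n) {t : ℝ}
    (ht : (m : ℝ) ≤ t) :
    (Fintype.card F : ℝ) ^ (qEntropy (Fintype.card F) (m / n) * n) ≤
      (n + 1) * #(puncturedBall F n t) := by
  have hq : 2 ≤ Fintype.card F := Fintype.one_lt_card
  rw [rpow_qEntropy_mul hq]
  have hcast : ((Fintype.card F - 1 : ℕ) : ℝ) = (Fintype.card F : ℝ) - 1 := by
    rw [Nat.cast_sub (by omega), Nat.cast_one]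
  have hcard : (((Fintype.card F : ℝ) - 1) ^ m * n.choose m : ℝ) ≤ #(puncturedBall F n t) := by
    rw [← hcast]
    have : #{v : Fin n → F | hammingNorm v = m} ≤ #(puncturedBall F n t) := by
      refine Finset.card_le_card fun v hv => ?_
      have hv : hammingNorm v = m := (mem_filter.1 hv).2
      refine mem_filter.2 ⟨mem_univ _, hammingNorm_ne_zero_iff.1 (by omega), by rwa [hv]⟩
    rw [card_hammingNorm_eq] at this
    exact_mod_cast this
  have hmode : (n : ℝ) ^ n ≤ (n + 1) * (n.choose m * ((m : ℝ) ^ m * ((n : ℝ) - m) ^ (n - m))) := by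
    rw [← Nat.cast_sub hmn.le]
    exact_mod_cast pow_self_le_succ_mul_choose_mul hmn.le
  have hq2 : (2 : ℝ) ≤ Fintype.card F := by exact_mod_cast hq
  set q : ℝ := (Fintype.card F : ℝ)
  have hqpos : 0 < q - 1 := by linarith
  have hm0 : (0 : ℝ) < m := by exact_mod_cast hm
  have hn0 : (0 : ℝ) < n := by exact_mod_cast hm.trans hmn
  have hl0 : (0 : ℝ) < n - m := sub_pos.2 (by exact_mod_cast hmn)
  have hexp : Real.exp (n * (m / n * Real.log (q - 1) - m / n * Real.log (m / n)
      - (1 - m / n) * Real.log (1 - m / n))) * ((m : ℝ) ^ m * ((n : ℝ) - m) ^ (n - m))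
      = (q - 1) ^ m * (n : ℝ) ^ n := by
    have e : (1 : ℝ) - m / n = (n - m) / n := by field_simp
    rw [e, Real.log_div hm0.ne' hn0.ne', Real.log_div hl0.ne' hn0.ne']
    simp only [← Real.rpow_natCast, Nat.cast_sub hmn.le]
    rw [Real.rpow_def_of_pos hm0, Real.rpow_def_of_pos hl0, Real.rpow_def_of_pos hqpos,
      Real.rpow_def_of_pos hn0, ← Real.exp_add, ← Real.exp_add, ← Real.exp_add]
    congr 1
    field_simp
    ring
  have hD : 0 < (m : ℝ) ^ m * ((n : ℝ) - m) ^ (n - m) := by positivity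
  refine le_of_mul_le_mul_right ?_ hD
  rw [hexp]
  calc (q - 1) ^ m * (n : ℝ) ^ n
      ≤ (q - 1) ^ m * ((n + 1) * (n.choose m * ((m : ℝ) ^ m * ((n : ℝ) - m) ^ (n - m)))) := by
        gcongr
    _ = (n + 1) * ((q - 1) ^ m * n.choose m) * ((m : ℝ) ^ m * ((n : ℝ) - m) ^ (n - m)) := by
        ring
    _ ≤ _ := by gcongr

end HammingBall

section Plin

variable (F : Type) [Field F] [Fintype F] [DecidableEq F]

theorem Plin_eq (r δ : ℝ) (n : ℕ) :
    Plin F (Fintype.card F) r δ n =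
      (#{M : Matrix (Fin ⌊r * (n : ℝ)⌋₊) (Fin n) F |
        ∀ b, Matrix.vecMul b M ∉ puncturedBall F n (δ * n)} : ℝ) /
      Fintype.card (Matrix (Fin ⌊r * (n : ℝ)⌋₊) (Fin n) F) := by
  rw [Plin, ← Set.ncard_coe_finset]
  congr 2
  · congr 1
    ext M
    simp [puncturedBall]
  · rw [Fintype.card_congr (Matrix.of (m := Fin ⌊r * (n : ℝ)⌋₊) (n := Fin n) (α := F)).symm,
      Fintype.card_fun, Fintype.card_fun]
    simp [← pow_mul, mul_comm]

theorem Plin_le_one (r δ : ℝ) (n : ℕ) : Plin F (Fintype.card F) r δ n ≤ 1 := by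
  rw [Plin_eq]
  exact div_le_one_of_le₀ (by exact_mod_cast Finset.card_le_univ _) (by positivity)

theorem one_sub_le_Plin (r δ : ℝ) (n : ℕ) :
    1 - ((Fintype.card F : ℝ) ^ ⌊r * (n : ℝ)⌋₊ - 1) *
      (#(puncturedBall F n (δ * n)) / (Fintype.card F : ℝ) ^ n) ≤ Plin F (Fintype.card F) r δ n := by
  have h := card_exists_vecMul_mem_le (ι := Fin ⌊r * (n : ℝ)⌋₊)
    (zero_notMem_puncturedBall (F := F) n (δ * n))
  have hc := Finset.card_filter_add_card_filter_not
    (s := (univ : Finset (Matrix (Fin ⌊r * (n : ℝ)⌋₊) (Fin n) F)))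
    (fun M => ∃ b, Matrix.vecMul b M ∈ puncturedBall F n (δ * n))
  simp only [not_exists, Finset.card_univ] at hc
  have hA : (0 : ℝ) < Fintype.card (Matrix (Fin ⌊r * (n : ℝ)⌋₊) (Fin n) F) := by
    exact_mod_cast Fintype.card_pos
  rw [Plin_eq, le_div_iff₀ hA]
  simp only [Fintype.card_fun, Fintype.card_fin, Nat.cast_pow] at h
  have hc' := congrArg (Nat.cast (R := ℝ)) hc
  push_cast at hc'
  linarith

theorem Plin_mul_le (r δ : ℝ) (n : ℕ) :
    Plin F (Fintype.card F) r δ n * (((Fintype.card F : ℝ) ^ ⌊r * (n : ℝ)⌋₊ - 1) *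
      (#(puncturedBall F n (δ * n)) / (Fintype.card F : ℝ) ^ n)) ≤ Fintype.card F := by
  have h := card_forall_vecMul_notMem_mul_le (ι := Fin ⌊r * (n : ℝ)⌋₊)
    (zero_notMem_puncturedBall (F := F) n (δ * n))
  have hA : (0 : ℝ) < Fintype.card (Matrix (Fin ⌊r * (n : ℝ)⌋₊) (Fin n) F) := by
    exact_mod_cast Fintype.card_pos
  rw [Plin_eq]
  simp only [Fintype.card_fun, Fintype.card_fin, Nat.cast_pow] at h
  set μ : ℝ := ((Fintype.card F : ℝ) ^ ⌊r * (n : ℝ)⌋₊ - 1) *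
      (#(puncturedBall F n (δ * n)) / (Fintype.card F : ℝ) ^ n)
  have hμ : 0 ≤ μ := by
    refine mul_nonneg (sub_nonneg.2 (one_le_pow₀ ?_)) (by positivity)
    exact_mod_cast Fintype.card_pos
  rcases hμ.eq_or_lt with h0 | hpos
  · rw [← h0]; simp
  rw [div_mul_eq_mul_div, div_le_iff₀ hA]
  refine le_of_mul_le_mul_right ?_ hpos
  linarith

theorem tendsto_Plin_one {r δ : ℝ} (hr0 : 0 < r) (hδ0 : 0 < δ)
    (hδ1 : δ < 1 - 1 / (Fintype.card F : ℝ)) (h : r < gvBound (Fintype.card F) δ) :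
    Tendsto (Plin F (Fintype.card F) r δ) atTop (𝓝 1) := by
  have hq1 : (1 : ℝ) < Fintype.card F := by exact_mod_cast Fintype.one_lt_card
  have hball := card_puncturedBall_le (F := F) hδ0 hδ1
  rw [gvBound] at h
  set η := qEntropy (Fintype.card F) δ
  have hlow (n : ℕ) : 1 - ((Fintype.card F : ℝ) ^ (r + η - 1)) ^ n ≤
      Plin F (Fintype.card F) r δ n := by
    refine le_trans (sub_le_sub_left ?_ 1) (one_sub_le_Plin F r δ n)
    calc _ ≤ (Fintype.card F : ℝ) ^ (r * n) *
          ((Fintype.card F : ℝ) ^ (η * n) / (Fintype.card F : ℝ) ^ (n : ℝ)) := by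
          rw [Real.rpow_natCast]
          gcongr
          · refine (sub_le_self _ zero_le_one).trans ?_
            rw [← Real.rpow_natCast]
            exact Real.rpow_le_rpow_of_exponent_le hq1.le (Nat.floor_le (by positivity))
          · exact hball n
      _ = _ := by
          rw [← Real.rpow_sub (by positivity), ← Real.rpow_add (by positivity),
            ← Real.rpow_mul_natCast (by positivity)]
          congr 1
          ring
  have hlim : Tendsto (fun n : ℕ => 1 - ((Fintype.card F : ℝ) ^ (r + η - 1)) ^ n) atTop (𝓝 1) := by
    have := tendsto_pow_atTop_nhds_zero_of_lt_one (r := (Fintype.card F : ℝ) ^ (r + η - 1))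
      (by positivity) (Real.rpow_lt_one_of_one_lt_of_neg hq1 (by linarith))
    simpa using this.const_sub 1
  exact tendsto_of_tendsto_of_tendsto_of_le_of_le hlim tendsto_const_nhds hlow
    fun n => Plin_le_one F r δ n

theorem tendsto_Plin_zero {r δ : ℝ} (hr0 : 0 < r) (hδ0 : 0 < δ) (hδ1 : δ < 1)
    (h : gvBound (Fintype.card F) δ < r) :
    Tendsto (Plin F (Fintype.card F) r δ) atTop (𝓝 0) := by
  have hq2 : (2 : ℝ) ≤ Fintype.card F := by exact_mod_cast Fintype.one_lt_card
  have hq1 : (1 : ℝ) < Fintype.card F := by linarith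
  rw [gvBound] at h
  obtain ⟨ε, hε0, hε⟩ : ∃ ε : ℝ, 0 < ε ∧ 1 - r - qEntropy (Fintype.card F) δ < -ε :=
    ⟨(qEntropy (Fintype.card F) δ + r - 1) / 2, by linarith, by linarith⟩
  have hfloor : Tendsto (fun n : ℕ => (⌊δ * n⌋₊ : ℝ) / n) atTop (𝓝 δ) :=
    (tendsto_nat_floor_mul_div_atTop hδ0.le).comp tendsto_natCast_atTop_atTop
  have hent := ((continuousAt_qEntropy (Fintype.card F) hδ0.ne' hδ1.ne).tendsto.comp
    hfloor).eventually_const_lt (show 1 - r + ε < qEntropy (Fintype.card F) δ by linarith)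
  have hlarge {c : ℝ} (hc : 0 < c) : ∀ᶠ n : ℕ in atTop, 1 ≤ c * n :=
    (tendsto_natCast_atTop_atTop.const_mul_atTop hc).eventually_ge_atTop 1
  have hbound : ∀ᶠ n : ℕ in atTop, Plin F (Fintype.card F) r δ n ≤
      2 * (Fintype.card F : ℝ) ^ 2 * ((n + 1) * ((Fintype.card F : ℝ) ^ (-ε)) ^ n) := by
    filter_upwards [hent, hlarge hδ0, hlarge hr0, eventually_gt_atTop 0] with n hn hδn hrn hn0
    have hn0' : (0 : ℝ) < n := by exact_mod_cast hn0
    have hfl : (⌊δ * n⌋₊ : ℝ) ≤ δ * n := Nat.floor_le (by positivity)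
    have hmn : ⌊δ * n⌋₊ < n := by
      have : (⌊δ * n⌋₊ : ℝ) < n := hfl.trans_lt (by nlinarith)
      exact_mod_cast this
    have hball := rpow_qEntropy_le_card_puncturedBall (F := F) (Nat.floor_pos.2 hδn) hmn hfl
    have hP := Plin_mul_le F r δ n
    have hP0 : 0 ≤ Plin F (Fintype.card F) r δ n := by rw [Plin_eq]; positivity
    have hk1 : (1 : ℕ) ≤ ⌊r * n⌋₊ := Nat.floor_pos.2 hrn
    have hkr : r * n - 1 ≤ (⌊r * n⌋₊ : ℝ) := (Nat.sub_one_lt_floor _).le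
    simp only [Function.comp_apply] at hn
    set q : ℝ := (Fintype.card F : ℝ)
    have hq0 : 0 < q := by linarith
    set B : ℝ := (#(puncturedBall F n (δ * n)) : ℝ)
    have hK : q ^ (r * n - 1) / 2 ≤ q ^ ⌊r * (n : ℝ)⌋₊ - 1 := by
      have h1 : q ^ (r * n - 1) ≤ q ^ ⌊r * (n : ℝ)⌋₊ := by
        rw [← Real.rpow_natCast]
        exact Real.rpow_le_rpow_of_exponent_le hq1.le hkr
      have h2 : q ≤ q ^ ⌊r * (n : ℝ)⌋₊ := le_self_pow₀ hq1.le (by omega)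
      linarith
    have hB : q ^ ((1 - r + ε) * n) / (n + 1) ≤ B := by
      rw [div_le_iff₀' (by positivity)]
      refine le_trans ?_ hball
      exact Real.rpow_le_rpow_of_exponent_le hq1.le (by gcongr)
    have hμ : q ^ (ε * n) / (2 * q * (n + 1)) ≤ (q ^ ⌊r * (n : ℝ)⌋₊ - 1) * (B / q ^ n) := by
      calc q ^ (ε * n) / (2 * q * (n + 1))
          = q ^ (r * n - 1) / 2 * (q ^ ((1 - r + ε) * n) / (n + 1) / q ^ n) := by
            have e : q ^ (ε * n) * (q * q ^ n)⁻¹ * q ^ n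
                = q ^ (r * n - 1) * q ^ ((1 - r + ε) * n) * (q ^ n)⁻¹ := by
              rw [← Real.rpow_add hq0]
              have e2 : r * n - 1 + (1 - r + ε) * n = ε * n + n - 1 := by ring
              rw [e2, Real.rpow_sub_one hq0.ne', Real.rpow_add_natCast hq0.ne']
              field_simp
            have hqn : q ^ n ≠ 0 := by positivity
            field_simp at e ⊢
            linear_combination e
        _ ≤ _ := by
            have hK0 : 0 ≤ q ^ ⌊r * (n : ℝ)⌋₊ - 1 := le_trans (by positivity) hK
            gcongr
    have hμP := (mul_le_mul_of_nonneg_left hμ hP0).trans hP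
    rw [mul_div_assoc', div_le_iff₀ (by positivity)] at hμP
    rw [← Real.rpow_mul_natCast hq0.le, neg_mul, Real.rpow_neg hq0.le]
    refine ((le_div_iff₀ (by positivity)).2 hμP).trans_eq ?_
    field_simp
  have hlim : Tendsto (fun n : ℕ => 2 * (Fintype.card F : ℝ) ^ 2 *
      (((n : ℝ) + 1) * ((Fintype.card F : ℝ) ^ (-ε)) ^ n)) atTop (𝓝 0) := by
    have hc0 : 0 ≤ (Fintype.card F : ℝ) ^ (-ε) := by positivity
    have hc1 : (Fintype.card F : ℝ) ^ (-ε) < 1 :=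
      Real.rpow_lt_one_of_one_lt_of_neg hq1 (by linarith)
    have := ((tendsto_self_mul_const_pow_of_lt_one hc0 hc1).add
      (tendsto_pow_atTop_nhds_zero_of_lt_one hc0 hc1)).const_mul (2 * (Fintype.card F : ℝ) ^ 2)
    simpa [add_mul] using this
  refine tendsto_of_tendsto_of_tendsto_of_le_of_le' tendsto_const_nhds hlim
    (Eventually.of_forall fun n => ?_) hbound
  rw [Plin_eq]
  positivity

end Plin

/-- the GV bound is a phase transition point for random linear codes:
the probability that every nonzero codeword of the random code `C_M` has relative
weight `> δ` tends to `1` if `r < g_q(δ)` and to `0` if `r > g_q(δ)`. -/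
theorem statement2 (F : Type) [Field F] [Fintype F] [DecidableEq F]
    (q : ℕ) (hq : q = Fintype.card F) (r δ : ℝ) (hr0 : 0 < r) (hr1 : r < 1)
    (hδ0 : 0 < δ) (hδ1 : δ < 1 - 1 / (q : ℝ)) :
    (r < gvBound q δ →
      Filter.Tendsto (Plin F q r δ) Filter.atTop (nhds 1)) ∧
    (gvBound q δ < r →
      Filter.Tendsto (Plin F q r δ) Filter.atTop (nhds 0)) := by
  subst hq
  refine ⟨tendsto_Plin_one F hr0 hδ0 hδ1, tendsto_Plin_zero F hr0 hδ0 (hδ1.trans_le ?_)⟩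
  exact sub_le_self _ (by positivity)
end

section
/- Let F be a finite field with q elements, let C ⊆ F^n be a balanced code of length n with information length k, and let 0 ≤ δ ≤ 1 − 1/q. Then |C^{≤δ}| ≤ q^{k·h_q(δ)}, where C^{≤δ} = {c ∈ C : w(c) ≤ δ·n}. -/
/-- `I : κ → Finset ι` is a balanced system of information index sets of the code
`C ⊆ F^ι` with information length `k`: each `I j` has `k` elements, each coordinate
lies in exactly `t ≥ 1` of the sets `I j`, and each coordinate projection
`F^ι → F^{I j}` maps `C` bijectively onto the full space `F^{I j}`. -/
def IsBalancedSystem {F ι κ : Type*} [Fintype ι] [DecidableEq ι] [Fintype κ]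
    (k : ℕ) (C : Set (ι → F)) (I : κ → Finset ι) : Prop :=
  (∀ j, (I j).card = k) ∧
  (∃ t : ℕ, 1 ≤ t ∧ ∀ i : ι, (Finset.univ.filter fun j : κ => i ∈ I j).card = t) ∧
  (∀ j, Set.BijOn (fun c : ι → F => fun i : (I j : Finset ι) => c i.1) C Set.univ)

/-- `C ⊆ F^ι` is a balanced code with information length `k`. -/
def IsBalancedCode {F ι : Type*} [Fintype ι] [DecidableEq ι]
    (k : ℕ) (C : Set (ι → F)) : Prop :=
  ∃ (s : ℕ) (I : Fin s → Finset ι), IsBalancedSystem k C I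

/-- A product distribution gives total mass at most one to a finite set of words that are
determined by their coordinates in `J`. -/
theorem sum_prod_le_one_of_injOn {F ι : Type*} [Fintype F] [DecidableEq F] [DecidableEq ι]
    (μ : F → ℝ) (hμ : ∀ a, 0 ≤ μ a) (hμ1 : ∑ a, μ a = 1) (J : Finset ι) (A : Finset (ι → F))
    (hA : Set.InjOn (fun c : ι → F => fun i : J => c i.1) (A : Set (ι → F))) :
    ∑ c ∈ A, ∏ i ∈ J, μ (c i) ≤ 1 := by
  have h1 : ∑ c ∈ A, ∏ i ∈ J, μ (c i) =
      ∑ x ∈ A.image (fun c : ι → F => fun i : J => c i.1), ∏ i : J, μ (x i) := by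
    rw [Finset.sum_image hA]
    exact Finset.sum_congr rfl fun c _ => (Finset.prod_coe_sort J fun i => μ (c i)).symm
  have h2 : ∑ x : J → F, ∏ i : J, μ (x i) = 1 := by
    have h := Finset.prod_univ_sum (fun _ : J => (Finset.univ : Finset F)) (fun _ a => μ a)
    rw [Fintype.piFinset_univ] at h
    rw [← h]
    simp [hμ1]
  rw [h1, ← h2]
  exact Finset.sum_le_sum_of_subset_of_nonneg (Finset.subset_univ _)
    fun x _ _ => Finset.prod_nonneg fun i _ => hμ _

/-- Double counting of the incidences of a system of index sets covering each index `t` times. -/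
theorem sum_sum_eq_mul_sum_of_card_filter {ι κ : Type*} [Fintype ι] [DecidableEq ι] [Fintype κ]
    (I : κ → Finset ι) (t : ℕ)
    (ht : ∀ i : ι, (Finset.univ.filter fun j : κ => i ∈ I j).card = t) (f : ι → ℝ) :
    ∑ j, ∑ i ∈ I j, f i = t * ∑ i, f i := by
  have h : ∀ j, ∑ i ∈ I j, f i = ∑ i, if i ∈ I j then f i else 0 := fun j => by
    rw [← Finset.sum_filter]
    simp
  simp_rw [h]
  rw [Finset.sum_comm, Finset.mul_sum]
  refine Finset.sum_congr rfl fun i _ => ?_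
  rw [← Finset.sum_filter, Finset.sum_const, ht, nsmul_eq_mul]

/-- If every word of `A` has average log-likelihood at least `-b` under the distribution `exp ∘ l`,
then `A` has at most `exp (k * b)` words. -/
theorem card_le_exp_of_isBalancedSystem {F ι κ : Type*} [Fintype F] [DecidableEq F]
    [Fintype ι] [DecidableEq ι] [Fintype κ] [Nonempty κ]
    {k : ℕ} {C : Set (ι → F)} {I : κ → Finset ι} (hI : IsBalancedSystem k C I)
    (l : F → ℝ) (hl : ∑ a, Real.exp (l a) = 1) (b : ℝ) (A : Finset (ι → F))
    (hAC : (A : Set (ι → F)) ⊆ C)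
    (hAb : ∀ c ∈ A, -(Fintype.card ι * b) ≤ ∑ i, l (c i)) :
    (A.card : ℝ) ≤ Real.exp (k * b) := by
  obtain ⟨hk, ⟨t, -, ht⟩, hbij⟩ := hI
  set s : ℝ := (Fintype.card κ : ℝ) with hs
  have hs0 : 0 < s := by
    rw [hs]
    exact_mod_cast Fintype.card_pos
  have hcount : s * k = t * Fintype.card ι := by
    have h := sum_sum_eq_mul_sum_of_card_filter I t ht fun _ => 1
    simpa [hk] using h
  have hpt : ∀ c ∈ A, Real.exp (-(k * b)) ≤ ∑ j, s⁻¹ * ∏ i ∈ I j, Real.exp (l (c i)) := by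
    intro c hc
    have hJ := convexOn_exp.map_sum_le (t := (Finset.univ : Finset κ)) (w := fun _ => s⁻¹)
      (p := fun j => ∑ i ∈ I j, l (c i)) (fun _ _ => by positivity)
      (by simp [← hs, hs0.ne']) (fun _ _ => Set.mem_univ _)
    simp only [smul_eq_mul] at hJ
    simp_rw [← Real.exp_sum]
    refine le_trans (Real.exp_le_exp.mpr ?_) hJ
    rw [← Finset.mul_sum, sum_sum_eq_mul_sum_of_card_filter I t ht fun i => l (c i),
      inv_mul_eq_div, le_div_iff₀ hs0]
    calc -(k * b) * s = t * -(Fintype.card ι * b) := by linear_combination (-b) * hcount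
      _ ≤ t * ∑ i, l (c i) := mul_le_mul_of_nonneg_left (hAb c hc) (by positivity)
  have hsum : (A.card : ℝ) * Real.exp (-(k * b)) ≤ 1 := by
    calc (A.card : ℝ) * Real.exp (-(k * b)) = ∑ c ∈ A, Real.exp (-(k * b)) := by simp
      _ ≤ ∑ c ∈ A, ∑ j, s⁻¹ * ∏ i ∈ I j, Real.exp (l (c i)) := Finset.sum_le_sum hpt
      _ = ∑ j, s⁻¹ * ∑ c ∈ A, ∏ i ∈ I j, Real.exp (l (c i)) := by
        rw [Finset.sum_comm]
        simp_rw [Finset.mul_sum]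
      _ ≤ ∑ j : κ, s⁻¹ * 1 := by
        refine Finset.sum_le_sum fun j _ => mul_le_mul_of_nonneg_left ?_ (by positivity)
        exact sum_prod_le_one_of_injOn _ (fun a => (Real.exp_pos _).le) hl (I j) A
          ((hbij j).injOn.mono hAC)
      _ = 1 := by simp [← hs, hs0.ne']
  rwa [Real.exp_neg, ← div_eq_mul_inv, div_le_one (Real.exp_pos _)] at hsum

theorem rpow_mul_qEntropy {q : ℕ} (hq : 1 < q) (x δ : ℝ) :
    (q : ℝ) ^ (x * qEntropy q δ) = Real.exp (x * (δ * Real.log ((q : ℝ) - 1) - δ * Real.log δ -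
      (1 - δ) * Real.log (1 - δ))) := by
  have hq1 : (1 : ℝ) < q := by exact_mod_cast hq
  have hlog := (Real.log_pos hq1).ne'
  rw [Real.rpow_def_of_pos (by linarith)]
  congr 1
  simp only [qEntropy, Real.logb]
  field_simp

theorem qEntropy_nonneg {q : ℕ} (hq : 1 < q) {δ : ℝ} (h0 : 0 ≤ δ) (h1 : δ ≤ 1) :
    0 ≤ qEntropy q δ := by
  have hq2 : (2 : ℝ) ≤ q := by exact_mod_cast hq
  have h2 : 0 ≤ Real.logb q ((q : ℝ) - 1) :=
    Real.logb_nonneg (by linarith) (by linarith)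
  have h3 : Real.logb q δ ≤ 0 := Real.logb_nonpos (by linarith) h0 h1
  have h4 : Real.logb q (1 - δ) ≤ 0 := Real.logb_nonpos (by linarith) (by linarith) (by linarith)
  have h5 := mul_nonneg h0 h2
  have h6 := mul_nonpos_of_nonneg_of_nonpos h0 h3
  have h7 := mul_nonpos_of_nonneg_of_nonpos (sub_nonneg.mpr h1) h4
  unfold qEntropy
  linarith

theorem sum_ite_eq_zero_eq_hammingNorm {F ι : Type*} [Zero F] [DecidableEq F] [Fintype ι]
    (c : ι → F) (x y : ℝ) :
    ∑ i, (if c i = 0 then x else y) =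
      Fintype.card ι * x - hammingNorm c * (x - y) := by
  have h : ∀ i, (if c i = 0 then x else y) = x - if c i ≠ 0 then x - y else 0 := fun i => by
    by_cases hi : c i = 0 <;> simp [hi]
  simp_rw [h]
  rw [Finset.sum_sub_distrib, ← Finset.sum_filter]
  simp [hammingNorm]
  ring

/-- if `C` is a balanced code of length `n` with information length `k`
and `0 ≤ δ ≤ 1 - 1/q`, then `|C^{≤δ}| ≤ q^{k·h_q(δ)}`. -/
theorem statement7 (F : Type) [Field F] [Fintype F] [DecidableEq F]
    (q n k : ℕ) (hq : q = Fintype.card F) (δ : ℝ)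
    (hδ0 : 0 ≤ δ) (hδ1 : δ ≤ 1 - 1 / (q : ℝ))
    (C : Set (Fin n → F)) (hC : IsBalancedCode k C) :
    (({c | c ∈ C ∧ (hammingNorm c : ℝ) ≤ δ * n}.ncard : ℝ))
      ≤ (q : ℝ) ^ ((k : ℝ) * qEntropy q δ) := by
  have hq1 : 1 < q := hq ▸ Fintype.one_lt_card
  have hqR : (1 : ℝ) < q := by exact_mod_cast hq1
  have hδlt : δ < 1 := by
    have : 0 < 1 / (q : ℝ) := by positivity
    linarith
  by_cases htriv : δ * n = 0
  · have hsub : {c | c ∈ C ∧ (hammingNorm c : ℝ) ≤ δ * n} ⊆ {0} := by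
      rintro c ⟨-, hc⟩
      rw [htriv] at hc
      have : hammingNorm c ≤ 0 := by exact_mod_cast hc
      exact hammingNorm_eq_zero.mp (Nat.le_zero.mp this)
    have hcard : {c | c ∈ C ∧ (hammingNorm c : ℝ) ≤ δ * n}.ncard ≤ 1 := by
      simpa using Set.ncard_le_ncard hsub
    calc (({c | c ∈ C ∧ (hammingNorm c : ℝ) ≤ δ * n}.ncard : ℝ)) ≤ 1 := by exact_mod_cast hcard
      _ ≤ (q : ℝ) ^ ((k : ℝ) * qEntropy q δ) := Real.one_le_rpow hqR.le
        (mul_nonneg k.cast_nonneg (qEntropy_nonneg hq1 hδ0 hδlt.le))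
  have hδpos : 0 < δ := hδ0.lt_of_ne fun h => htriv (by simp [← h])
  have hn : n ≠ 0 := fun h => htriv (by simp [h])
  obtain ⟨s, I, hI⟩ := hC
  obtain ⟨t, ht1, ht⟩ := hI.2.1
  have : Nonempty (Fin s) := by
    have h : (Finset.univ.filter fun j : Fin s =>
        (⟨0, Nat.pos_of_ne_zero hn⟩ : Fin n) ∈ I j).Nonempty :=
      Finset.card_pos.mp (by rw [ht]; exact ht1)
    exact ⟨h.choose⟩
  have hq10 : 0 < (q : ℝ) - 1 := by linarith
  have h1δ : 0 < 1 - δ := by linarith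
  classical
  rw [Set.ncard_eq_toFinset_card', rpow_mul_qEntropy hq1]
  refine card_le_exp_of_isBalancedSystem hI
    (fun a => if a = 0 then Real.log (1 - δ) else Real.log (δ / (q - 1))) ?_ _ _ ?_ ?_
  · have hexp : ∀ a : F, Real.exp (if a = 0 then Real.log (1 - δ) else Real.log (δ / (q - 1))) =
        δ / (q - 1) + if a = 0 then (1 - δ) - δ / (q - 1) else 0 := fun a => by
      split_ifs
      · rw [Real.exp_log h1δ]
        ring
      · rw [Real.exp_log (by positivity), add_zero]
    simp_rw [hexp]
    rw [Finset.sum_add_distrib]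
    simp only [Finset.sum_const, Finset.card_univ, ← hq, nsmul_eq_mul, Finset.sum_ite_eq',
      Finset.mem_univ, if_true]
    field_simp
    ring
  · intro c hc
    simp only [Set.coe_toFinset] at hc
    exact hc.1
  · intro c hc
    have hw : (hammingNorm c : ℝ) ≤ δ * n := (Set.mem_toFinset.mp hc).2
    rw [sum_ite_eq_zero_eq_hammingNorm, Fintype.card_fin]
    have hle : Real.log (δ / (q - 1)) ≤ Real.log (1 - δ) := by
      refine Real.log_le_log (by positivity) ?_
      rw [div_le_iff₀ hq10]
      have : δ * q ≤ (1 - 1 / (q : ℝ)) * q := mul_le_mul_of_nonneg_right hδ1 (by positivity)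
      rw [sub_mul, one_div, inv_mul_cancel₀ (by positivity)] at this
      linarith
    have h := mul_le_mul_of_nonneg_right hw (sub_nonneg.mpr hle)
    rw [Real.log_div hδpos.ne' hq10.ne'] at h ⊢
    linarith
end
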